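/- arXiv:1302.4295 — 3 statements merged into one kernel-verified Lean document; each statement's English description precedes it below -/
import Mathlib

section
/- Let n ≥ 1 and 1 ≤ t ≤ n be integers and let W ⊆ ℚ^(S_n) be the span of all functions f_{I,J}(π) = 1 if π(I) = J and 0 otherwise, over pairs of t-tuples I, J of distinct elements of [n]. Then dim(W) equals the number of permutations σ ∈ S_n whose longest increasing subsequence has length at least n − t. -/
/-- The subspace `W ⊆ ℚ^(S_n)` spanned by the indicators `f_{I,J}(π) = 1_{π(I) = J}` over
pairs of `t`-tuples `I, J` of distinct elements of `[n]`. -/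
def twiseSpace (n t : ℕ) : Submodule ℚ (Equiv.Perm (Fin n) → ℚ) :=
  Submodule.span ℚ {f : Equiv.Perm (Fin n) → ℚ |
    ∃ I J : Fin t → Fin n, Function.Injective I ∧ Function.Injective J ∧
      f = fun π => if ∀ k, π (I k) = J k then 1 else 0}

namespace TwiseSpace

open Finset

variable {n : ℕ}

/-- Two distinct permutations have a first position where they differ. -/
lemma exists_first_ne {σ π : Equiv.Perm (Fin n)} (hne : σ ≠ π) :
    ∃ i, σ i ≠ π i ∧ ∀ j < i, σ j = π j := by
  obtain ⟨i, hi, hmin⟩ := wellFounded_lt.has_min {i | σ i ≠ π i} (DFunLike.ne_iff.1 hne)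
  exact ⟨i, hi, fun j hj => by_contra fun h => hmin j h hj⟩

/-- A permutation that increases on the set where it differs from `π` is lexicographically
smaller than `π`. -/
lemma toLex_lt_of_strictMonoOn {σ π : Equiv.Perm (Fin n)} {A : Set (Fin n)}
    (hA : StrictMonoOn σ A) (hπ : ∀ i ∉ A, π i = σ i) (hne : σ ≠ π) :
    toLex (⇑σ) < toLex (⇑π) := by
  obtain ⟨i, hi, hlt⟩ := exists_first_ne hne
  refine ⟨i, hlt, ?_⟩
  have hiA : i ∈ A := by
    by_contra h
    exact hi (hπ i h).symm
  obtain ⟨j, hj⟩ := σ.surjective (π i)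
  have hjπ : π j ≠ σ j := fun h => by
    have : j = i := π.injective (h.trans hj)
    subst this
    exact hi hj
  have hjA : j ∈ A := by
    by_contra h
    exact hjπ (hπ j h)
  have hij : i < j := by
    rcases lt_trichotomy i j with h | h | h
    · exact h
    · subst h; exact absurd hj hi
    · exact absurd (hlt j h).symm hjπ
  change σ i < π i
  rw [← hj]
  exact hA hiA hjA hij

/-- If `σ` decreases on every fibre of `c`, then permuting the positions inside the fibres makes
`σ` lexicographically smaller. -/
lemma toLex_mul_lt_of_fiberwise_anti {σ τ : Equiv.Perm (Fin n)} {c : Fin n → ℕ}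
    (hc : ∀ i j, i < j → c i = c j → σ j < σ i) (hτ : ∀ i, c (τ i) = c i) (hne : τ ≠ 1) :
    toLex (⇑(σ * τ)) < toLex (⇑σ) := by
  obtain ⟨i, hi, hlt⟩ := exists_first_ne hne
  simp only [Equiv.Perm.one_apply] at hi hlt
  refine ⟨i, fun j hj => congrArg σ (hlt j hj), ?_⟩
  have hij : i < τ i := by
    rcases lt_trichotomy i (τ i) with h | h | h
    · exact h
    · exact absurd h.symm hi
    · exact absurd (τ.injective (hlt _ h)) hi
  exact hc i (τ i) hij (hτ i).symm

/-- A permutation without an increasing subsequence of length `m` is decreasing on each fibre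
of a colouring with the `m - 1` colours `1, ..., m - 1`. -/
lemma exists_coloring {σ : Equiv.Perm (Fin n)} {m : ℕ}
    (hσ : ¬ ∃ f : Fin m → Fin n, StrictMono f ∧ StrictMono (fun i => σ (f i))) :
    ∃ c : Fin n → ℕ, (∀ i, c i ∈ Ico 1 m) ∧ ∀ i j, i < j → c i = c j → σ j < σ i := by
  classical
  let C : Fin n → Finset (Finset (Fin n)) := fun i =>
    {s | StrictMonoOn σ (s : Set (Fin n)) ∧ i ∈ s ∧ ∀ j ∈ s, j ≤ i}
  have hC : ∀ i s, s ∈ C i ↔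
      StrictMonoOn σ (s : Set (Fin n)) ∧ i ∈ s ∧ ∀ j ∈ s, j ≤ i := fun i s => by simp [C]
  have hsingle : ∀ i, {i} ∈ C i := fun i => by simp [hC]
  refine ⟨fun i => (C i).sup card, fun i => ?_, fun i j hij heq => ?_⟩
  · rw [mem_Ico]
    refine ⟨by simpa using le_sup (f := card) (hsingle i), ?_⟩
    obtain ⟨s, hs, hcard⟩ := exists_mem_eq_sup (C i) ⟨_, hsingle i⟩ card
    change (C i).sup card < m
    rw [hcard]
    by_contra! hm
    obtain ⟨u, hus, hu⟩ := exists_subset_card_eq hm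
    refine hσ ⟨u.orderEmbOfFin hu, (u.orderEmbOfFin hu).strictMono, fun a b hab => ?_⟩
    exact ((hC i s).1 hs).1 (hus (orderEmbOfFin_mem u hu a)) (hus (orderEmbOfFin_mem u hu b))
      ((u.orderEmbOfFin hu).strictMono hab)
  · by_contra! hle
    have hlt : σ i < σ j := lt_of_le_of_ne hle fun h => hij.ne (σ.injective h)
    obtain ⟨s, hs, hcard⟩ := exists_mem_eq_sup (C i) ⟨_, hsingle i⟩ card
    obtain ⟨hmono, his, hmax⟩ := (hC i s).1 hs
    have hjs : j ∉ s := fun h => (hmax j h).not_gt hij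
    have hins : insert j s ∈ C j := by
      refine (hC _ _).2 ⟨?_, mem_insert_self _ _, ?_⟩
      · intro a ha b hb hab
        rw [mem_coe, mem_insert] at ha hb
        rcases ha with rfl | ha <;> rcases hb with rfl | hb
        · exact absurd hab (lt_irrefl _)
        · exact absurd (hab.trans_le (hmax b hb)) hij.not_gt
        · exact (hmono.monotoneOn ha his (hmax a ha)).trans_lt hlt
        · exact hmono ha hb hab
      · intro a ha
        rcases mem_insert.1 ha with rfl | ha
        · exact le_rfl
        · exact (hmax a ha).trans hij.le
    have := le_sup (f := card) hins
    rw [card_insert_of_notMem hjs, ← hcard] at this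
    change (C i).sup card = (C j).sup card at heq
    omega

/-- Antisymmetrizing over the fibres of a colouring with fewer than `n - t` colours kills
`twiseSpace n t`. -/
lemma sum_sign_mul_eq_zero {t : ℕ} (σ : Equiv.Perm (Fin n)) {c : Fin n → ℕ}
    {B : Finset ℕ} (hc : ∀ i, c i ∈ B) (hB : #B < n - t) {f : Equiv.Perm (Fin n) → ℚ}
    (hf : f ∈ twiseSpace n t) :
    ∑ τ : Equiv.Perm (Fin n) with ∀ i, c (τ i) = c i,
      ((Equiv.Perm.sign τ : ℤ) : ℚ) * f (σ * τ) = 0 := by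
  classical
  induction hf using Submodule.span_induction with
  | zero => simp
  | add f g _ _ hf hg => simp [mul_add, sum_add_distrib, hf, hg]
  | smul a f _ hf =>
    simp only [Pi.smul_apply, smul_eq_mul, mul_left_comm _ a]
    rw [← mul_sum, hf, mul_zero]
  | mem f hf =>
    obtain ⟨I, J, hI, -, rfl⟩ := hf
    have hcard : #B < #(univ.image I)ᶜ := by
      rwa [card_compl, card_image_of_injective _ hI, card_univ, Fintype.card_fin,
        Fintype.card_fin]
    obtain ⟨a, ha, b, hb, hab, hcab⟩ :=
      exists_ne_map_eq_of_card_lt_of_maps_to hcard (f := c) (fun i _ => hc i)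
    have hfix : ∀ k, Equiv.swap a b (I k) = I k := fun k =>
      Equiv.swap_apply_of_ne_of_ne (fun h => by simp [← h] at ha) (fun h => by simp [← h] at hb)
    have hcswap : ∀ i, c (Equiv.swap a b i) = c i := fun i => by
      rw [Equiv.swap_apply_def]
      split_ifs with h₁ h₂
      · rw [h₁, hcab]
      · rw [h₂, hcab]
      · rfl
    set F : Equiv.Perm (Fin n) → ℚ := fun π => if ∀ k, π (I k) = J k then 1 else 0
    have hF : ∀ π, F (π * Equiv.swap a b) = F π := fun π =>
      if_congr (by simp [hfix]) rfl rfl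
    refine sum_involution (fun τ _ => τ * Equiv.swap a b) ?_ ?_ ?_ ?_
    · intro τ _
      rw [← mul_assoc σ, hF (σ * τ), Equiv.Perm.sign_mul, Equiv.Perm.sign_swap hab]
      simp
    · intro τ _ _ h
      exact hab (Equiv.swap_eq_one_iff.1 (mul_eq_left.1 h))
    · intro τ hτ
      simp only [mem_filter, mem_univ, true_and] at hτ ⊢
      exact fun i => (hτ _).trans (hcswap i)
    · intro τ _
      simp [mul_assoc]

/-- The permutations of `[n]` with an increasing subsequence of length `m`. -/
abbrev IncreasingPerm (n m : ℕ) : Type :=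
  {σ : Equiv.Perm (Fin n) //
    ∃ f : Fin m → Fin n, StrictMono f ∧ StrictMono (fun i => σ (f i))}

/-- An element of `twiseSpace n t` is determined by its values on the permutations with an
increasing subsequence of length `n - t`. -/
lemma eq_zero_of_forall_increasingPerm {t : ℕ} {f : Equiv.Perm (Fin n) → ℚ}
    (hf : f ∈ twiseSpace n t) (h0 : ∀ σ : IncreasingPerm n (n - t), f σ = 0) : f = 0 := by
  classical
  by_contra hne
  have hex : ({σ | f σ ≠ 0} : Finset (Equiv.Perm (Fin n))).Nonempty := by
    obtain ⟨σ, hσ⟩ := Function.ne_iff.1 hne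
    exact ⟨σ, by simpa using hσ⟩
  obtain ⟨σ, hσ, hmin⟩ := exists_min_image _ (fun σ : Equiv.Perm (Fin n) => toLex (⇑σ)) hex
  simp only [mem_filter, mem_univ, true_and] at hσ hmin
  have hinc : ¬ ∃ g : Fin (n - t) → Fin n, StrictMono g ∧ StrictMono (fun i => σ (g i)) :=
    fun h => hσ (h0 ⟨σ, h⟩)
  have hpos : 0 < n - t := by
    rw [pos_iff_ne_zero]
    intro h
    have : IsEmpty (Fin (n - t)) := by rw [h]; infer_instance
    exact hinc ⟨isEmptyElim, fun a => isEmptyElim a, fun a => isEmptyElim a⟩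
  obtain ⟨c, hcB, hc⟩ := exists_coloring hinc
  have hsum := sum_sign_mul_eq_zero σ hcB (by rw [Nat.card_Ico]; omega) hf
  rw [sum_eq_single_of_mem 1 (by simp)] at hsum
  · exact hσ (by simpa using hsum)
  · intro τ hτ hτ1
    have hlt := toLex_mul_lt_of_fiberwise_anti hc (mem_filter.1 hτ).2 hτ1
    by_contra h
    exact (hmin (σ * τ) (right_ne_zero_of_mul h)).not_gt hlt

/-- For a permutation `σ` with an increasing subsequence of length `n - t` there is an element
of `twiseSpace n t` equal to `1` at `σ` and vanishing at the other permutations that are not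
lexicographically larger than `σ`. -/
lemma exists_triangular {t : ℕ} (htn : t ≤ n) (σ : IncreasingPerm n (n - t)) :
    ∃ f ∈ twiseSpace n t, f σ = 1 ∧
      ∀ π : Equiv.Perm (Fin n), π ≠ σ → f π ≠ 0 → toLex (⇑σ.1) < toLex (⇑π) := by
  classical
  obtain ⟨σ, g, hg, hσg⟩ := σ
  have hcard : #(univ.image g)ᶜ = t := by
    rw [card_compl, card_image_of_injective _ hg.injective, card_univ, Fintype.card_fin,
      Fintype.card_fin]
    omega
  let I := (univ.image g)ᶜ.orderEmbOfFin hcard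
  refine ⟨fun π => if ∀ k, π (I k) = σ (I k) then 1 else 0,
    Submodule.subset_span ⟨I, fun k => σ (I k), I.injective, σ.injective.comp I.injective, rfl⟩,
    by simp, fun π hne hπ => ?_⟩
  have hagree : ∀ k, π (I k) = σ (I k) := by
    by_contra h
    exact hπ (if_neg h)
  refine toLex_lt_of_strictMonoOn (A := Set.range g) ?_ (fun i hi => ?_) hne.symm
  · rintro _ ⟨a, rfl⟩ _ ⟨b, rfl⟩ hab
    exact hσg (hg.lt_iff_lt.1 hab)
  · have hmem : i ∈ Set.range I := by
      rw [range_orderEmbOfFin]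
      simpa using hi
    obtain ⟨k, rfl⟩ := hmem
    exact hagree k

lemma card_le_finrank {t : ℕ} (htn : t ≤ n) :
    Nat.card (IncreasingPerm n (n - t)) ≤ Module.finrank ℚ (twiseSpace n t) := by
  classical
  choose f hf hf1 hflt using exists_triangular (n := n) htn
  have hli : LinearIndependent ℚ
      (fun σ => (⟨f σ, hf σ⟩ : twiseSpace n t)) := by
    refine LinearIndependent.of_comp (twiseSpace n t).subtype ?_
    rw [Fintype.linearIndependent_iff]
    intro a ha
    by_contra! hne
    obtain ⟨σ, hσ, hmin⟩ := exists_min_image ({σ | a σ ≠ 0} : Finset (IncreasingPerm n (n - t)))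
      (fun σ => toLex (⇑σ.1)) (by obtain ⟨σ, hσ⟩ := hne; exact ⟨σ, by simpa using hσ⟩)
    simp only [mem_filter, mem_univ, true_and] at hσ hmin
    have hsum := congrFun ha σ.1
    simp only [Function.comp_apply, Submodule.subtype_apply, Finset.sum_apply, Pi.smul_apply,
      smul_eq_mul, Pi.zero_apply] at hsum
    rw [sum_eq_single_of_mem σ (mem_univ _), hf1, mul_one] at hsum
    · exact hσ hsum
    · intro τ _ hτ
      by_contra h
      exact (hmin τ (left_ne_zero_of_mul h)).not_gt
        (hflt τ σ (fun h' => hτ (Subtype.ext h').symm) (right_ne_zero_of_mul h))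
  rw [Nat.card_eq_fintype_card]
  exact hli.fintype_card_le_finrank

lemma finrank_le_card (t : ℕ) :
    Module.finrank ℚ (twiseSpace n t) ≤ Nat.card (IncreasingPerm n (n - t)) := by
  classical
  let r : twiseSpace n t →ₗ[ℚ] (IncreasingPerm n (n - t) → ℚ) :=
    (LinearMap.funLeft ℚ ℚ Subtype.val).comp (twiseSpace n t).subtype
  have hr : Function.Injective r := by
    rw [injective_iff_map_eq_zero]
    exact fun f hf => Subtype.ext (eq_zero_of_forall_increasingPerm f.2 (congrFun hf))
  rw [Nat.card_eq_fintype_card, ← Module.finrank_fintype_fun_eq_card ℚ]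
  exact LinearMap.finrank_le_finrank_of_injective hr

end TwiseSpace

/-- `dim W` equals the number of permutations of `[n]` whose longest increasing
subsequence has length at least `n − t` (i.e. which admit an increasing subsequence of
length `n − t`). -/
theorem twise_dim_eq_card_lis (n t : ℕ) (hn : 1 ≤ n) (ht : 1 ≤ t) (htn : t ≤ n) :
    Module.finrank ℚ (twiseSpace n t)
      = Nat.card {σ : Equiv.Perm (Fin n) //
          ∃ f : Fin (n - t) → Fin n, StrictMono f ∧ StrictMono (fun i => σ (f i))} :=
  le_antisymm (TwiseSpace.finrank_le_card t) (TwiseSpace.card_le_finrank htn)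
end

section
/- There exists a universal constant C > 0 such that the following holds. Let B be a finite set, A a finite index set, and ψ : B → ℤ^A a map with max_{b∈B, a∈A} |ψ(b)_a| ≤ c whose symmetry group acts transitively on B (i.e., for any b₁, b₂ ∈ B there is a permutation π of B with π(b₁) = b₂ such that the span of the coordinate functions b ↦ ψ(b)_a is invariant under precomposition with π). Then there exists an integer s with 1 ≤ s ≤ C·|A|·log(2c·|A|) such that ψ is (δ, s)-locally correctable with δ = 1/(8s). -/
/-- A map `ψ : B → ℤ^A` is `(δ, s)`-locally correctable if for any subset `E ⊆ B` with
`1 ≤ |E| ≤ δ·|B|` and any `e ∈ E`, there is an integer vector `γ` supported on `B∖E`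
with `‖γ‖₁ ≤ s` and `ψ(e) = Σ_{b∈B∖E} γ_b·ψ(b)`. -/
def IsLocallyCorrectable {B A : Type} [Fintype B] [Fintype A]
    (ψ : B → A → ℤ) (δ : ℝ) (s : ℕ) : Prop :=
  ∀ E : Finset B, 1 ≤ E.card → (E.card : ℝ) ≤ δ * (Fintype.card B : ℝ) →
    ∀ e ∈ E, ∃ γ : B → ℤ, (∀ b ∈ E, γ b = 0) ∧ (∑ b, |γ b|) ≤ (s : ℤ) ∧
      ∀ a, ψ e a = ∑ b, γ b * ψ b a

/-- A permutation `π` of `B` is a symmetry of `ψ` if the span of the coordinate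
functions `b ↦ ψ(b)_a` is invariant under precomposition with `π`. -/
def IsSymmetryOf {B A : Type} (ψ : B → A → ℤ) (π : Equiv.Perm B) : Prop :=
  ∀ f ∈ Submodule.span ℚ (Set.range fun a => fun b => (ψ b a : ℚ)),
    (f ∘ π) ∈ Submodule.span ℚ (Set.range fun a => fun b => (ψ b a : ℚ))

/-- Bounded integer vectors indexed by a large enough finite set admit a nontrivial linear
relation with coefficients in `{-1, 0, 1}`. -/
theorem exists_signed_relation {B A : Type} [Fintype B] [Fintype A] (ψ : B → A → ℤ) (c : ℕ)
    (hψ : ∀ b a, |ψ b a| ≤ (c : ℤ)) (T : Finset B)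
    (hT : (2 * c * T.card + 1) ^ Fintype.card A < 2 ^ T.card) :
    ∃ γ : B → ℤ, (∀ b, b ∉ T → γ b = 0) ∧ (∀ b, |γ b| ≤ 1) ∧ (∃ b, γ b ≠ 0) ∧
      ∀ a, ∑ b, γ b * ψ b a = 0 := by
  classical
  let R : Finset (A → ℤ) :=
    Fintype.piFinset fun _ => Finset.Icc (-((c * T.card : ℕ) : ℤ)) ((c * T.card : ℕ) : ℤ)
  have hR : R.card < T.powerset.card := by
    have hIcc : (Finset.Icc (-((c * T.card : ℕ) : ℤ)) ((c * T.card : ℕ) : ℤ)).card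
        = 2 * c * T.card + 1 := by
      rw [Int.card_Icc, mul_assoc]
      generalize c * T.card = k
      omega
    rw [Finset.card_powerset, Fintype.card_piFinset, Finset.prod_const, hIcc, Finset.card_univ]
    exact hT
  have hmaps : ∀ X ∈ T.powerset, (fun a => ∑ b ∈ X, ψ b a) ∈ R := by
    intro X hX
    rw [Fintype.mem_piFinset]
    intro a
    rw [Finset.mem_Icc, ← abs_le]
    calc |∑ b ∈ X, ψ b a| ≤ ∑ b ∈ X, |ψ b a| := Finset.abs_sum_le_sum_abs _ _
      _ ≤ ∑ b ∈ X, (c : ℤ) := Finset.sum_le_sum fun b _ => hψ b a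
      _ = ((c * X.card : ℕ) : ℤ) := by simp [mul_comm]
      _ ≤ ((c * T.card : ℕ) : ℤ) := by
        exact_mod_cast Nat.mul_le_mul_left c (Finset.card_le_card (Finset.mem_powerset.1 hX))
  obtain ⟨X, hX, Y, hY, hXY, hsum⟩ :=
    Finset.exists_ne_map_eq_of_card_lt_of_maps_to hR hmaps
  rw [Finset.mem_powerset] at hX hY
  refine ⟨fun b => (if b ∈ X then 1 else 0) - (if b ∈ Y then 1 else 0), ?_, ?_, ?_, ?_⟩
  · intro b hb
    have h₁ : b ∉ X := fun h => hb (hX h)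
    have h₂ : b ∉ Y := fun h => hb (hY h)
    simp [h₁, h₂]
  · intro b
    dsimp only
    split_ifs <;> simp
  · by_contra! h
    apply hXY
    ext b
    have hb := h b
    by_cases h₁ : b ∈ X <;> by_cases h₂ : b ∈ Y <;> simp_all
  · intro a
    have ha := congrFun hsum a
    simp [sub_mul, Finset.sum_sub_distrib, ite_mul, Finset.sum_ite_mem, ha]

/-- Symmetries of `ψ` preserve the linear relations among its values. -/
theorem IsSymmetryOf.relation_comp {B A : Type} [Fintype B] {ψ : B → A → ℤ}
    {π : Equiv.Perm B} (hπ : IsSymmetryOf ψ π) {γ : B → ℤ}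
    (hγ : ∀ a, ∑ b, γ b * ψ b a = 0) (a : A) : ∑ b, γ b * ψ (π b) a = 0 := by
  let φ : (B → ℚ) →ₗ[ℚ] ℚ := ∑ b, (γ b : ℚ) • LinearMap.proj b
  have hφ : ∀ f, φ f = ∑ b, (γ b : ℚ) * f b := fun f => by simp [φ]
  have hspan : Submodule.span ℚ (Set.range fun a => fun b => (ψ b a : ℚ)) ≤ LinearMap.ker φ := by
    rw [Submodule.span_le]
    rintro _ ⟨a, rfl⟩
    rw [SetLike.mem_coe, LinearMap.mem_ker, hφ]
    dsimp only
    exact_mod_cast hγ a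
  have h := hspan (hπ _ (Submodule.subset_span ⟨a, rfl⟩))
  rw [LinearMap.mem_ker, hφ] at h
  simp only [Function.comp_apply] at h
  exact_mod_cast h

/-- A finite digraph with out-degrees at most `d` has an independent set of size `t` inside
every vertex set of size at least `2 * d * t`. -/
theorem exists_independent_of_outdegree_le {B : Type} [Fintype B] (r : B → B → Prop)
    [DecidableRel r] (hr : ∀ b, r b b) (d : ℕ)
    (hd : ∀ b, (Finset.univ.filter fun b' => r b b').card ≤ d) (hd₀ : 0 < d) (t : ℕ) :
    ∀ S : Finset B, 2 * d * t ≤ S.card →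
      ∃ T ⊆ S, T.card = t ∧ ∀ u ∈ T, ∀ v ∈ T, u ≠ v → ¬ r u v := by
  classical
  induction t with
  | zero => exact fun S _ => ⟨∅, by simp, by simp, by simp⟩
  | succ t ih =>
    intro S hS
    have hS₀ : S.Nonempty := by
      rw [← Finset.card_pos]
      have : 0 < 2 * d * (t + 1) := by positivity
      omega
    obtain ⟨v, hv, hvd⟩ : ∃ v ∈ S, (S.filter fun u => r u v).card ≤ d := by
      apply Finset.exists_le_of_sum_le hS₀
      calc ∑ v ∈ S, (S.filter fun u => r u v).card
          = ∑ u ∈ S, (S.filter fun v => r u v).card :=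
            (Finset.sum_card_bipartiteAbove_eq_sum_card_bipartiteBelow r).symm
        _ ≤ ∑ _u ∈ S, d := Finset.sum_le_sum fun u _ =>
            (Finset.card_le_card (Finset.filter_subset_filter _ (Finset.subset_univ S))).trans
              (hd u)
    let N := (Finset.univ.filter fun u => r v u) ∪ (S.filter fun u => r u v)
    have hN : N.card ≤ 2 * d := by
      have h₁ := Finset.card_union_le (Finset.univ.filter fun u => r v u)
        (S.filter fun u => r u v)
      have h₂ := hd v
      change N.card ≤ _ at h₁
      omega
    have hSN : 2 * d * t ≤ (S \ N).card := by
      have := Finset.le_card_sdiff N S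
      rw [mul_add, mul_one] at hS
      omega
    obtain ⟨T, hTS, hTc, hT⟩ := ih (S \ N) hSN
    have hTN : ∀ u ∈ T, ¬ r v u ∧ ¬ r u v := by
      intro u hu
      have := hTS hu
      simp only [N, Finset.mem_sdiff, Finset.mem_union, Finset.mem_filter, Finset.mem_univ,
        true_and, not_or, not_and] at this
      exact ⟨this.2.1, this.2.2 this.1⟩
    have hvT : v ∉ T := fun h => (hTN v h).1 (hr v)
    refine ⟨insert v T, ?_, by rw [Finset.card_insert_of_notMem hvT, hTc], ?_⟩
    · exact Finset.insert_subset hv (hTS.trans Finset.sdiff_subset)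
    · intro x hx y hy hxy
      rw [Finset.mem_insert] at hx hy
      rcases hx with rfl | hx <;> rcases hy with rfl | hy
      · exact absurd rfl hxy
      · exact (hTN y hy).1
      · exact (hTN x hx).2
      · exact hT x hx y hy hxy

/-- A map with transitive symmetry group is locally correctable with query complexity `s` as soon
as `2 ^ s` exceeds the number of possible subset sums of `s` of its values. -/
theorem isLocallyCorrectable_of_pow_lt {B A : Type} [Fintype B] [Fintype A] (ψ : B → A → ℤ)
    (c s : ℕ) (hψ : ∀ b a, |ψ b a| ≤ (c : ℤ))
    (hsymm : ∀ b₁ b₂ : B, ∃ π : Equiv.Perm B, IsSymmetryOf ψ π ∧ π b₁ = b₂)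
    (hs₀ : 1 ≤ s) (hs : (2 * c * s + 1) ^ Fintype.card A < 2 ^ s) :
    IsLocallyCorrectable ψ (1 / (8 * s)) s := by
  classical
  intro E hE₀ hE e he
  have hEB : 2 * E.card * s ≤ (Finset.univ : Finset B).card := by
    have hs' : (0 : ℝ) < 8 * s := by positivity
    rw [one_div_mul_eq_div, le_div_iff₀ hs'] at hE
    have hE' : E.card * (8 * s) ≤ Fintype.card B := by exact_mod_cast hE
    rw [Finset.card_univ]
    nlinarith [Nat.zero_le (E.card * s)]
  choose π hπ hπe using fun b => hsymm b e
  obtain ⟨T, -, rfl, hT⟩ := exists_independent_of_outdegree_le (fun u v => π u v ∈ E)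
    (fun b => by simpa only [hπe] using he) E.card
    (fun b => Finset.card_le_card_of_injOn (π b) (fun x hx => by simpa using hx)
      (π b).injective.injOn) hE₀ s Finset.univ hEB
  obtain ⟨γ, hγT, hγ₁, ⟨i, hi⟩, hγ⟩ := exists_signed_relation ψ c hψ T hs
  have hiT : i ∈ T := by
    by_contra h
    exact hi (hγT i h)
  have hii : γ i * γ i = 1 := by
    have := abs_le.1 (hγ₁ i)
    have h : γ i = 1 ∨ γ i = -1 := by omega
    rcases h with h | h <;> simp [h]
  have hsymm_e : (π i).symm e = i := by rw [Equiv.symm_apply_eq, hπe]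
  refine ⟨fun b => if b = e then 0 else -γ i * γ ((π i).symm b), ?_, ?_, ?_⟩
  · intro b hb
    dsimp only
    split_ifs with hbe
    · rfl
    · rw [hγT ((π i).symm b), mul_zero]
      intro hu
      refine hT i hiT _ hu ?_ (by simpa using hb)
      intro h
      exact hbe (((π i).symm_apply_eq.1 h.symm).trans (hπe i))
  · calc ∑ b, |if b = e then 0 else -γ i * γ ((π i).symm b)|
        ≤ ∑ b, |γ ((π i).symm b)| := by
          refine Finset.sum_le_sum fun b _ => ?_
          split_ifs
          · simp
          · rw [abs_mul, abs_neg]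
            exact mul_le_of_le_one_left (abs_nonneg _) (hγ₁ i)
      _ = ∑ b, |γ b| := Equiv.sum_comp (π i).symm fun b => |γ b|
      _ = ∑ b ∈ T, |γ b| := by
          refine (Finset.sum_subset (Finset.subset_univ T) fun b _ hb => ?_).symm
          rw [hγT b hb, abs_zero]
      _ ≤ ∑ _b ∈ T, 1 := Finset.sum_le_sum fun b _ => hγ₁ b
      _ = (T.card : ℤ) := by simp
  · intro a
    have hrel : ∑ b, γ ((π i).symm b) * ψ b a = 0 := by
      rw [← (hπ i).relation_comp hγ a, ← Equiv.sum_comp (π i)]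
      simp
    have hterm : ∀ b, (if b = e then 0 else -γ i * γ ((π i).symm b)) * ψ b a
        = -γ i * (γ ((π i).symm b) * ψ b a) + if b = e then ψ e a else 0 := by
      intro b
      split_ifs with hbe
      · subst hbe
        rw [hsymm_e]
        linear_combination (ψ b a) * hii
      · ring
    simp only [hterm]
    rw [Finset.sum_add_distrib, ← Finset.mul_sum, hrel]
    simp

/-- The number of subset sums of `4 * m * L` vectors is small when `2 * c * m ≤ 2 ^ L`. -/
theorem subset_sum_count_lt {c m L : ℕ} (hm : 1 ≤ m) (hL : 1 ≤ L) (h : 2 * c * m ≤ 2 ^ L) :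
    (2 * c * (4 * m * L) + 1) ^ m < 2 ^ (4 * m * L) := by
  have hbase : 2 * c * (4 * m * L) + 1 < 2 ^ (4 * L) := by
    have h₁ : L < 2 ^ L := Nat.lt_two_pow_self
    have h₂ : 2 ≤ 2 ^ L := by simpa using Nat.pow_le_pow_right (n := 2) (by norm_num) hL
    have h₃ : 2 ^ (4 * L) = (2 ^ L) ^ 4 := by rw [mul_comm, pow_mul]
    rw [h₃]
    generalize 2 ^ L = x at *
    have h₄ : 2 * c * (4 * m * L) ≤ 4 * x * (x - 1) := by
      calc 2 * c * (4 * m * L) = 4 * (2 * c * m) * L := by ring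
        _ ≤ 4 * x * (x - 1) := by gcongr; omega
    obtain ⟨y, rfl⟩ := Nat.exists_eq_add_of_le h₂
    have h₅ : 2 + y - 1 = 1 + y := by omega
    rw [h₅] at h₄
    refine (Nat.add_le_add_right h₄ 1).trans_lt ?_
    ring_nf
    nlinarith [Nat.zero_le y, Nat.zero_le (y ^ 2), Nat.zero_le (y ^ 3), Nat.zero_le (y ^ 4)]
  calc (2 * c * (4 * m * L) + 1) ^ m < (2 ^ (4 * L)) ^ m := Nat.pow_lt_pow_left hbase (by omega)
    _ = 2 ^ (4 * m * L) := by rw [← pow_mul]; ring_nf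

/-- The ceiling of the binary logarithm is at most twice the binary logarithm. -/
theorem clog_two_le_two_mul_log {n : ℕ} (hn : 2 ≤ n) :
    (Nat.clog 2 n : ℝ) ≤ 2 * (Real.log n / Real.log 2) := by
  have hlog2 : 0 < Real.log 2 := Real.log_pos (by norm_num)
  have hpow : 2 ^ (Nat.clog 2 n - 1) ≤ n :=
    (Nat.pow_pred_clog_lt_self (by norm_num) (by omega)).le
  have hclog : 1 ≤ Nat.clog 2 n := Nat.clog_pos (by norm_num) hn
  have h₁ : ((Nat.clog 2 n : ℝ) - 1) * Real.log 2 ≤ Real.log n := by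
    have h : ((2 : ℝ) ^ (Nat.clog 2 n - 1)) ≤ n := by exact_mod_cast hpow
    have h' := Real.log_le_log (by positivity) h
    rwa [Real.log_pow, Nat.cast_sub hclog, Nat.cast_one] at h'
  have h₂ : Real.log 2 ≤ Real.log n := Real.log_le_log (by norm_num) (by exact_mod_cast hn)
  rw [mul_div_assoc', le_div_iff₀ hlog2]
  linarith

/-- If `‖ψ‖_∞ ≤ c` and the symmetry group of `ψ` acts transitively on `B`, then `ψ` is
`(δ, s)`-locally correctable for some `s ≤ C·|A|·log(2c·|A|)` and `δ = 1/(8s)`. -/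
theorem bounded_symmetric_implies_locally_correctable :
    ∃ C : ℝ, 0 < C ∧
      ∀ (B A : Type) [Fintype B] [Fintype A] [Nonempty A] (ψ : B → A → ℤ) (c : ℕ),
        1 ≤ c →
        (∀ b a, |ψ b a| ≤ (c : ℤ)) →
        (∀ b₁ b₂ : B, ∃ π : Equiv.Perm B, IsSymmetryOf ψ π ∧ π b₁ = b₂) →
        ∃ s : ℕ, 1 ≤ s ∧
          (s : ℝ) ≤ C * (Fintype.card A : ℝ) * Real.log (2 * c * (Fintype.card A : ℝ)) ∧
          IsLocallyCorrectable ψ (1 / (8 * s)) s := by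
  have hlog2 : 0 < Real.log 2 := Real.log_pos (by norm_num)
  refine ⟨8 / Real.log 2, by positivity, ?_⟩
  intro B A _ _ _ ψ c hc hψ hsymm
  have hm : 1 ≤ Fintype.card A := Fintype.card_pos
  have hx : 2 ≤ 2 * c * Fintype.card A := by
    have := Nat.mul_le_mul hc hm
    nlinarith
  have hL : 1 ≤ Nat.clog 2 (2 * c * Fintype.card A) := Nat.clog_pos (by norm_num) hx
  have hs₀ : 1 ≤ 4 * Fintype.card A * Nat.clog 2 (2 * c * Fintype.card A) :=
    Nat.mul_pos (Nat.mul_pos (by norm_num) hm) hL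
  refine ⟨_, hs₀, ?_, isLocallyCorrectable_of_pow_lt ψ c _ hψ hsymm hs₀
    (subset_sum_count_lt hm hL (Nat.le_pow_clog (by norm_num) _))⟩
  have hclog := clog_two_le_two_mul_log hx
  push_cast at hclog ⊢
  calc 4 * (Fintype.card A : ℝ) * Nat.clog 2 (2 * c * Fintype.card A)
      ≤ 4 * (Fintype.card A : ℝ) *
        (2 * (Real.log (2 * c * (Fintype.card A : ℝ)) / Real.log 2)) := by gcongr
    _ = 8 / Real.log 2 * (Fintype.card A : ℝ) * Real.log (2 * c * (Fintype.card A : ℝ)) := by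
      ring
end

section
/- There exists a universal constant C > 0 such that the following holds. Let B be a finite set, A a finite index set, and ψ : B → ℤ^A a map with max_{b∈B, a∈A} |ψ(b)_a| ≤ c. Then for any subset S ⊆ B of size |S| ≥ C·|A|·log(2c·|A|) there exists a vector γ ∈ {−1,0,1}^S having at least |S|/4 non-zero coordinates and satisfying Σ_{b∈S} γ_b·ψ(b) = 0. -/
/-- The number of subsets of an `n`-element set with at most `n / 4` elements is at most
`(256 / 27) ^ (n / 4)`. -/
theorem card_small_subsets_pow_mul_le {α : Type*} (S : Finset α) :
    (S.powerset.filter fun U => 4 * U.card ≤ S.card).card ^ 4 * 27 ^ S.card ≤ 256 ^ S.card := by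
  set F := S.powerset.filter fun U => 4 * U.card ≤ S.card with hF
  have hsum := Finset.sum_pow_mul_eq_add_pow (1 : ℝ) 3 S
  set w : ℝ := (27 : ℝ) ^ ((S.card : ℝ) / 4) with hw
  have hw4 : w ^ 4 = 27 ^ S.card := by
    rw [hw, ← Real.rpow_natCast, ← Real.rpow_mul (by norm_num), ← Real.rpow_natCast]
    congr 1
    push_cast
    ring
  have hterm : ∀ U ∈ F, w ≤ (1 : ℝ) ^ U.card * 3 ^ (S.card - U.card) := by
    intro U hU
    have hU4 : 4 * U.card ≤ S.card := (Finset.mem_filter.mp hU).2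
    rw [one_pow, one_mul]
    refine le_of_pow_le_pow_left₀ (n := 4) (by norm_num) (by positivity) ?_
    rw [hw4, ← pow_mul, show (27 : ℝ) = 3 ^ 3 by norm_num, ← pow_mul]
    exact pow_le_pow_right₀ (by norm_num) (by omega)
  have hle : (F.card : ℝ) * w ≤ 4 ^ S.card := by
    calc (F.card : ℝ) * w = ∑ U ∈ F, w := by simp
      _ ≤ ∑ U ∈ F, (1 : ℝ) ^ U.card * 3 ^ (S.card - U.card) := Finset.sum_le_sum hterm
      _ ≤ ∑ U ∈ S.powerset, (1 : ℝ) ^ U.card * 3 ^ (S.card - U.card) :=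
        Finset.sum_le_sum_of_subset_of_nonneg (Finset.filter_subset _ _)
          fun _ _ _ => by positivity
      _ = 4 ^ S.card := by rw [hsum]; norm_num
  have h4 := pow_le_pow_left₀ (by positivity) hle 4
  rw [mul_pow, hw4, ← pow_mul, mul_comm S.card 4, pow_mul] at h4
  norm_num at h4
  exact_mod_cast h4

/-- Two subsets of `S` with the same `ψ`-sum and large symmetric difference exist as soon as
`2 ^ |S|` exceeds the number of possible sums times the number of small subsets. -/
theorem exists_subsets_sum_eq_of_lt {A B : Type*} [Fintype A] [DecidableEq B] (ψ : B → A → ℤ)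
    (c : ℕ) (hψ : ∀ b a, |ψ b a| ≤ (c : ℤ)) (S : Finset B)
    (hlt : (2 * c * S.card + 1) ^ Fintype.card A *
      (S.powerset.filter fun U => 4 * U.card ≤ S.card).card < 2 ^ S.card) :
    ∃ T ⊆ S, ∃ U ⊆ S, S.card < 4 * (symmDiff T U).card ∧
      ∀ a, ∑ b ∈ T, ψ b a = ∑ b ∈ U, ψ b a := by
  classical
  let R : Finset (A → ℤ) :=
    Fintype.piFinset fun _ => Finset.Icc (-(c * S.card : ℤ)) (c * S.card)
  have hR : R.card = (2 * c * S.card + 1) ^ Fintype.card A := by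
    simp only [R, Fintype.card_piFinset, Int.card_Icc, Finset.prod_const, Finset.card_univ]
    congr 1
    have : (c * S.card + 1 - -(c * S.card) : ℤ) = ((2 * c * S.card + 1 : ℕ) : ℤ) := by
      push_cast; ring
    rw [this, Int.toNat_natCast]
  have hmaps : ∀ T ∈ S.powerset, (fun a => ∑ b ∈ T, ψ b a) ∈ R := by
    intro T hT
    rw [Fintype.mem_piFinset]
    intro a
    rw [Finset.mem_Icc, ← abs_le]
    calc |∑ b ∈ T, ψ b a| ≤ ∑ b ∈ T, |ψ b a| := Finset.abs_sum_le_sum_abs _ _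
      _ ≤ ∑ _b ∈ T, (c : ℤ) := Finset.sum_le_sum fun b _ => hψ b a
      _ = c * T.card := by simp [mul_comm]
      _ ≤ c * S.card := by
        have := Finset.card_le_card (Finset.mem_powerset.mp hT)
        gcongr
  obtain ⟨v, -, hv⟩ := Finset.exists_lt_card_fiber_of_mul_lt_card_of_maps_to hmaps
    (by rwa [hR, Finset.card_powerset])
  obtain ⟨T, hT⟩ := Finset.card_pos.mp (pos_of_gt hv)
  rw [Finset.mem_filter, Finset.mem_powerset] at hT
  by_contra! hcon
  refine absurd hv (not_lt.mpr (Finset.card_le_card_of_injOn (symmDiff T) ?_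
    (symmDiff_right_injective T).injOn))
  intro U hU
  rw [Finset.mem_coe, Finset.mem_filter, Finset.mem_powerset] at hU
  rw [Finset.mem_coe, Finset.mem_filter, Finset.mem_powerset]
  refine ⟨symmDiff_le_sup.trans (Finset.union_subset hT.1 hU.1), ?_⟩
  by_contra! hlarge
  obtain ⟨a, ha⟩ := hcon T hT.1 U hU.1 hlarge
  exact ha (congrFun (hT.2.trans hU.2.symm) a)

theorem mul_log_lt_of_mul_log_le {c d n : ℝ} (hc : 1 ≤ c) (hd : 1 ≤ d)
    (h : 200 * d * Real.log (2 * c * d) ≤ n) :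
    d * Real.log (2 * c * n + 1) < n / 10 := by
  have hlog2 := Real.log_two_gt_d9
  have hlog2' := Real.log_two_lt_d9
  have hcd : 1 ≤ c * d := one_le_mul_of_one_le_of_one_le hc hd
  have hL : Real.log 2 ≤ Real.log (2 * c * d) := Real.log_le_log (by norm_num) (by nlinarith)
  set L := Real.log (2 * c * d) with hLdef
  have hdL : 0.69 * d ≤ d * L := by nlinarith
  have hn : 1 ≤ n := by nlinarith
  have hcn : 1 ≤ c * n := one_le_mul_of_one_le_of_one_le hc hn
  have hsplit : Real.log (2 * c * n + 1) ≤ 7 * Real.log 2 + L + Real.log (n / (64 * d)) := by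
    have hpow : 7 * Real.log 2 = Real.log (2 ^ 7) := by rw [Real.log_pow]; norm_num
    rw [hpow, hLdef, ← Real.log_mul (by positivity) (by positivity),
      ← Real.log_mul (by positivity) (by positivity)]
    refine Real.log_le_log (by positivity) ?_
    have : (2 ^ 7 * (2 * c * d) * (n / (64 * d)) : ℝ) = 4 * (c * n) := by
      field_simp
      norm_num
    rw [this]
    linarith
  have hlogle : Real.log (n / (64 * d)) ≤ n / (64 * d) - 1 :=
    Real.log_le_sub_one_of_pos (by positivity)
  have hdiv : d * (n / (64 * d)) = n / 64 := by field_simp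
  calc d * Real.log (2 * c * n + 1)
      ≤ d * (4.9 + L + (n / (64 * d) - 1)) := by
        refine mul_le_mul_of_nonneg_left ?_ (by linarith)
        linarith
    _ = 3.9 * d + d * L + n / 64 := by rw [mul_add, mul_sub, hdiv]; ring
    _ < n / 10 := by linarith

theorem pow_mul_card_small_subsets_lt {α : Type*} (S : Finset α) {c d : ℕ} (hc : 1 ≤ c)
    (hd : 1 ≤ d) (h : 200 * (d : ℝ) * Real.log (2 * c * d) ≤ (S.card : ℝ)) :
    (2 * c * S.card + 1) ^ d * (S.powerset.filter fun U => 4 * U.card ≤ S.card).card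
      < 2 ^ S.card := by
  set N := (S.powerset.filter fun U => 4 * U.card ≤ S.card).card
  have hN : N ^ 4 * 27 ^ S.card ≤ 256 ^ S.card := card_small_subsets_pow_mul_le S
  by_contra! hcon
  have hlog := mul_log_lt_of_mul_log_le (by exact_mod_cast hc) (by exact_mod_cast hd) h
  have hpow : (16 * 27) ^ S.card ≤ ((2 * c * S.card + 1) ^ d) ^ 4 * 256 ^ S.card := by
    calc (16 * 27) ^ S.card = (2 ^ S.card) ^ 4 * 27 ^ S.card := by
          rw [mul_pow, ← pow_mul, mul_comm S.card 4, pow_mul]; norm_num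
      _ ≤ ((2 * c * S.card + 1) ^ d * N) ^ 4 * 27 ^ S.card := by gcongr
      _ = ((2 * c * S.card + 1) ^ d) ^ 4 * (N ^ 4 * 27 ^ S.card) := by ring
      _ ≤ _ := by gcongr
  have hreal : (27 / 16 : ℝ) ^ S.card ≤ ((2 * c * S.card + 1 : ℝ) ^ d) ^ 4 := by
    have hcast : (16 * 27 : ℝ) ^ S.card ≤
        ((2 * c * S.card + 1 : ℝ) ^ d) ^ 4 * 256 ^ S.card := by exact_mod_cast hpow
    rw [show (16 * 27 : ℝ) = 27 / 16 * 256 by norm_num, mul_pow] at hcast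
    exact le_of_mul_le_mul_right hcast (by positivity)
  have hle := Real.log_le_log (by positivity) hreal
  rw [Real.log_pow, Real.log_pow, Real.log_pow] at hle
  have hbase : (0.4 : ℝ) ≤ Real.log (27 / 16) := by
    have := Real.one_sub_inv_le_log_of_pos (show (0 : ℝ) < 27 / 16 by norm_num)
    norm_num at this ⊢
    linarith
  have hmul := mul_le_mul_of_nonneg_left hbase (Nat.cast_nonneg (α := ℝ) S.card)
  push_cast at hle
  linarith

/-- If every coordinate of every `ψ(b)` is bounded by `c` in absolute value, then any
subset `S ⊆ B` of size `≥ C·|A|·log(2c·|A|)` carries a `{−1,0,1}`-vector `γ` with at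
least `|S|/4` non-zero coordinates and `Σ_{b∈S} γ_b·ψ(b) = 0`. -/
theorem exists_short_zero_combination :
    ∃ C : ℝ, 0 < C ∧
      ∀ (B A : Type) [Fintype B] [Fintype A] (ψ : B → A → ℤ) (c : ℕ),
        (∀ b a, |ψ b a| ≤ (c : ℤ)) →
        ∀ S : Finset B,
          C * (Fintype.card A : ℝ) * Real.log (2 * c * (Fintype.card A : ℝ))
            ≤ (S.card : ℝ) →
          ∃ γ : B → ℤ, (∀ b, γ b = -1 ∨ γ b = 0 ∨ γ b = 1) ∧
            (∀ b ∉ S, γ b = 0) ∧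
            (S.card : ℝ) / 4 ≤ ((S.filter fun b => γ b ≠ 0).card : ℝ) ∧
            ∀ a, ∑ b ∈ S, γ b * ψ b a = 0 := by
  classical
  refine ⟨200, by norm_num, fun B A _ _ ψ c hψ S hS => ?_⟩
  by_cases hzero : ∀ b a, ψ b a = 0
  · refine ⟨fun b => if b ∈ S then 1 else 0, fun b => ?_, fun b hb => if_neg hb, ?_, ?_⟩
    · by_cases hb : b ∈ S <;> simp [hb]
    · rw [Finset.filter_true_of_mem fun b hb => by simp [hb]]
      linarith [Nat.cast_nonneg (α := ℝ) S.card]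
    · simp [hzero]
  push Not at hzero
  obtain ⟨b₀, a₀, hne⟩ := hzero
  have hc : 1 ≤ c := by
    have := abs_pos.mpr hne
    have := hψ b₀ a₀
    omega
  have hd : 1 ≤ Fintype.card A := Fintype.card_pos_iff.mpr ⟨a₀⟩
  obtain ⟨T, hT, U, hU, hcard, hsum⟩ := exists_subsets_sum_eq_of_lt ψ c hψ S
    (pow_mul_card_small_subsets_lt S hc hd hS)
  refine ⟨fun b => (if b ∈ T then 1 else 0) - (if b ∈ U then 1 else 0), fun b => ?_,
    fun b hb => ?_, ?_, fun a => ?_⟩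
  · by_cases hbT : b ∈ T <;> by_cases hbU : b ∈ U <;> simp [hbT, hbU]
  · simp [Finset.notMem_mono hT hb, Finset.notMem_mono hU hb]
  · have hsub : symmDiff T U ⊆
        S.filter fun b => ((if b ∈ T then 1 else 0) - (if b ∈ U then 1 else 0) : ℤ) ≠ 0 := by
      intro b hb
      rw [Finset.mem_symmDiff] at hb
      rw [Finset.mem_filter]
      rcases hb with ⟨h, h'⟩ | ⟨h, h'⟩
      · exact ⟨hT h, by simp [h, h']⟩
      · exact ⟨hU h, by simp [h, h']⟩
    have hle := hcard.le.trans (Nat.mul_le_mul_left 4 (Finset.card_le_card hsub))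
    rw [div_le_iff₀ (by norm_num), mul_comm]
    exact_mod_cast hle
  · simp only [sub_mul, ite_mul, one_mul, zero_mul, Finset.sum_sub_distrib,
      Finset.sum_ite_mem, Finset.inter_eq_right.mpr hT, Finset.inter_eq_right.mpr hU, hsum a,
      sub_self]
end
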